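/- arXiv:1110.4918 — 4 statements merged into one kernel-verified Lean document; each statement's English description precedes it below -/
import Mathlib

section
/- For every integer k ≥ 1 there exists a constant C_k > 0 such that for all integers n ≥ k and all real t with 0 < t < 2^(−k), one has 2·(1 − exp(−n·t^k)) ≤ C_k · Σ_{m=k}^{n} (n choose m) · exp(−2(n−m)t) · (1 − exp(−2t))^m. -/
/-- The probability that a binomial variable with `n` trials, success weight `p` and failure
weight `q` takes a value less than `k`. -/
def binomialLowerTail (p q : ℝ) (n k : ℕ) : ℝ :=
  ∑ m ∈ Finset.range k, (n.choose m : ℝ) * p ^ m * q ^ (n - m)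

namespace binomialLowerTail

variable {p q : ℝ}

theorem zero_right (n : ℕ) : binomialLowerTail p q n 0 = 0 := by
  simp [binomialLowerTail]

theorem zero_succ (k : ℕ) : binomialLowerTail p q 0 (k + 1) = 1 := by
  simp [binomialLowerTail, Finset.sum_range_succ']

theorem succ_succ (n k : ℕ) :
    binomialLowerTail p q (n + 1) (k + 1) =
      p * binomialLowerTail p q n k + q * binomialLowerTail p q n (k + 1) := by
  unfold binomialLowerTail
  rw [Finset.sum_range_succ', Finset.sum_range_succ' _ k, mul_add, ← add_assoc,
    Finset.mul_sum, Finset.mul_sum, ← Finset.sum_add_distrib]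
  congr 1
  · refine Finset.sum_congr rfl fun m _ => ?_
    rw [Nat.choose_succ_succ, Nat.add_sub_add_right]
    rcases lt_or_ge m n with h | h
    · obtain ⟨d, rfl⟩ := Nat.exists_eq_add_of_lt h
      rw [show m + d + 1 - m = d + 1 by lia, show m + d + 1 - (m + 1) = d by lia]
      push_cast
      ring
    · rw [Nat.choose_eq_zero_of_lt (show n < m + 1 by lia)]
      push_cast
      ring
  · simp [pow_succ, mul_comm]

theorem nonneg (hp : 0 ≤ p) (hq : 0 ≤ q) (n k : ℕ) : 0 ≤ binomialLowerTail p q n k :=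
  Finset.sum_nonneg fun _ _ => by positivity

theorem le_succ_right (hp : 0 ≤ p) (hq : 0 ≤ q) (n k : ℕ) :
    binomialLowerTail p q n k ≤ binomialLowerTail p q n (k + 1) := by
  rw [binomialLowerTail, binomialLowerTail, Finset.sum_range_succ]
  exact le_add_of_nonneg_right (by positivity)

/-- If `n + m` trials yield fewer than `k` successes, so do the first `n` and the last `m`. -/
theorem add_le_mul (hp : 0 ≤ p) (hq : 0 ≤ q) (n m k : ℕ) :
    binomialLowerTail p q (n + m) k ≤ binomialLowerTail p q n k * binomialLowerTail p q m k := by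
  induction n generalizing k with
  | zero => cases k <;> simp [zero_right, zero_succ]
  | succ n ih =>
    cases k with
    | zero => simp [zero_right]
    | succ k =>
      rw [Nat.add_right_comm, succ_succ, succ_succ]
      calc _ ≤ p * (binomialLowerTail p q n k * binomialLowerTail p q m (k + 1)) +
            q * (binomialLowerTail p q n (k + 1) * binomialLowerTail p q m (k + 1)) := by
            gcongr
            · exact (ih k).trans (mul_le_mul_of_nonneg_left (le_succ_right hp hq m k)
                (nonneg hp hq n k))
            · exact ih (k + 1)
        _ = _ := by ring

theorem add_sum_Icc (hpq : p + q = 1) {n k : ℕ} (hkn : k ≤ n) :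
    binomialLowerTail p q n k +
      ∑ m ∈ Finset.Icc k n, (n.choose m : ℝ) * p ^ m * q ^ (n - m) = 1 := by
  have h : Finset.Icc k n = Finset.Ico k (n + 1) := by
    ext; simp only [Finset.mem_Icc, Finset.mem_Ico]; lia
  rw [binomialLowerTail, h, Finset.sum_range_add_sum_Ico _ (by lia)]
  calc _ = (p + q) ^ n := by
        rw [add_pow]
        exact Finset.sum_congr rfl fun _ _ => by ring
    _ = 1 := by rw [hpq, one_pow]

theorem self (hpq : p + q = 1) (k : ℕ) : binomialLowerTail p q k k = 1 - p ^ k := by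
  have h := add_sum_Icc hpq (le_refl k)
  simp only [Finset.Icc_self, Finset.sum_singleton, Nat.choose_self, Nat.sub_self,
    Nat.cast_one, one_mul, pow_zero, mul_one] at h
  linarith

theorem le_one (hp : 0 ≤ p) (hq : 0 ≤ q) (hpq : p + q = 1) (n k : ℕ) :
    binomialLowerTail p q n k ≤ 1 := by
  induction n generalizing k with
  | zero => cases k <;> simp [zero_right, zero_succ]
  | succ n ih =>
    cases k with
    | zero => simp [zero_right]
    | succ k =>
      rw [succ_succ]
      nlinarith [ih k, ih (k + 1)]

theorem le_pow (hp : 0 ≤ p) (hq : 0 ≤ q) (hpq : p + q = 1) (k r b : ℕ) :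
    binomialLowerTail p q (k * b + r) k ≤ (1 - p ^ k) ^ b := by
  induction b with
  | zero => simpa using le_one hp hq hpq r k
  | succ b ih =>
    rw [show k * (b + 1) + r = k + (k * b + r) by ring, pow_succ', ← self hpq]
    rw [← self hpq] at ih
    exact (add_le_mul hp hq _ _ _).trans (mul_le_mul_of_nonneg_left ih (nonneg hp hq k k))

end binomialLowerTail

theorem le_one_sub_exp_neg_two_mul {t : ℝ} (h0 : 0 ≤ t) (h1 : t ≤ 1 / 2) :
    t ≤ 1 - Real.exp (-2 * t) := by
  have h : Real.exp (-2 * t) * Real.exp (2 * t) = 1 := by rw [← Real.exp_add]; simp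
  nlinarith [Real.add_one_le_exp (2 * t), Real.exp_pos (-2 * t)]

theorem one_sub_exp_neg_mul_le (N : ℕ) (y : ℝ) :
    1 - Real.exp (-(N * y)) ≤ N * (1 - Real.exp (-y)) := by
  have h := one_add_mul_le_pow (a := Real.exp (-y) - 1) (by linarith [Real.exp_pos (-y)]) N
  rw [add_sub_cancel, ← Real.exp_nat_mul, mul_neg] at h
  linarith

/-- The analytic core of Proposition 5.1: for every `k ≥ 1` there is a constant `C_k > 0`
such that for all `n ≥ k` and `0 < t < 2^(-k)`,
`2(1 - e^{-n t^k}) ≤ C_k ∑_{m=k}^n (n choose m) e^{-2(n-m)t} (1 - e^{-2t})^m`. -/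
theorem stmt0 (k : ℕ) (hk : 1 ≤ k) :
    ∃ C : ℝ, 0 < C ∧ ∀ n : ℕ, k ≤ n → ∀ t : ℝ, 0 < t → t < (2 : ℝ) ^ (-(k : ℤ)) →
      2 * (1 - Real.exp (-((n : ℝ) * t ^ k))) ≤
        C * ∑ m ∈ Finset.Icc k n,
          (n.choose m : ℝ) * Real.exp (-2 * ((n : ℝ) - (m : ℝ)) * t) *
            (1 - Real.exp (-2 * t)) ^ m := by
  refine ⟨4 * k, by positivity, fun n hkn t ht0 ht => ?_⟩
  have ht1 : t ≤ 1 / 2 := by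
    refine ht.le.trans ?_
    calc (2 : ℝ) ^ (-(k : ℤ)) ≤ 2 ^ (-1 : ℤ) := zpow_le_zpow_right₀ (by norm_num) (by lia)
      _ = 1 / 2 := by norm_num
  set q := Real.exp (-2 * t) with hq
  set p := 1 - q
  have hq0 : 0 ≤ q := (Real.exp_pos _).le
  have htp : t ≤ p := le_one_sub_exp_neg_two_mul ht0.le ht1
  have hp0 : 0 ≤ p := ht0.le.trans htp
  have hpq : p + q = 1 := sub_add_cancel 1 q
  have hsum : ∑ m ∈ Finset.Icc k n,
      (n.choose m : ℝ) * Real.exp (-2 * ((n : ℝ) - (m : ℝ)) * t) * p ^ m =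
        1 - binomialLowerTail p q n k := by
    rw [← binomialLowerTail.add_sum_Icc hpq hkn, add_sub_cancel_left]
    refine Finset.sum_congr rfl fun m hm => ?_
    rw [hq, ← Real.exp_nat_mul, Nat.cast_sub (Finset.mem_Icc.1 hm).2, mul_right_comm]
    ring_nf
  rw [hsum]
  set b := n / k
  have hb1 : 1 ≤ b := (Nat.one_le_div_iff hk).2 hkn
  have hnb : n ≤ 2 * k * b := by
    have h1 : k * b + n % k = n := Nat.div_add_mod n k
    have h2 := Nat.mod_lt n hk
    have h3 := Nat.mul_le_mul_left k hb1
    linarith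
  have htail : binomialLowerTail p q n k ≤ Real.exp (-(b * t ^ k)) :=
    calc binomialLowerTail p q n k
        = binomialLowerTail p q (k * b + n % k) k := by rw [Nat.div_add_mod]
      _ ≤ (1 - p ^ k) ^ b := binomialLowerTail.le_pow hp0 hq0 hpq k _ b
      _ ≤ Real.exp (-p ^ k) ^ b := by
          gcongr
          · exact sub_nonneg.2 (pow_le_one₀ hp0 (by linarith))
          · exact Real.one_sub_le_exp_neg _
      _ = Real.exp (-(b * p ^ k)) := by rw [← Real.exp_nat_mul, mul_neg]
      _ ≤ Real.exp (-(b * t ^ k)) := by gcongr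
  calc 2 * (1 - Real.exp (-((n : ℝ) * t ^ k)))
      ≤ 2 * (1 - Real.exp (-((2 * k : ℕ) * (b * t ^ k)))) := by
        rw [← mul_assoc, ← Nat.cast_mul]
        gcongr
    _ ≤ 2 * ((2 * k : ℕ) * (1 - Real.exp (-(b * t ^ k)))) := by
        gcongr
        exact one_sub_exp_neg_mul_le _ _
    _ = 4 * k * (1 - Real.exp (-(b * t ^ k))) := by push_cast; ring
    _ ≤ 4 * k * (1 - binomialLowerTail p q n k) := by gcongr
end

section
/- For every integer k ≥ 1 there exists M > 0 such that for all integers n ≥ k and all real t with 0 < t < 2^(−k) and n·t ≥ M, one has Σ_{m=k}^{n} (n choose m) · exp(−2(n−m)t) · (1 − exp(−2t))^m ≥ 1/2. -/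
/-- The binomial expansion of `1 = ((1 - e^{-2t}) + e^{-2t})^n`. -/
theorem sum_binomial_exp_eq_one (n : ℕ) (t : ℝ) :
    ∑ m ∈ Finset.range (n + 1),
      (n.choose m : ℝ) * Real.exp (-2 * ((n : ℝ) - (m : ℝ)) * t) *
        (1 - Real.exp (-2 * t)) ^ m = 1 := by
  have h := add_pow (1 - Real.exp (-2 * t)) (Real.exp (-2 * t)) n
  rw [sub_add_cancel, one_pow] at h
  refine Eq.trans ?_ h.symm
  refine Finset.sum_congr rfl fun m hm => ?_
  have hmn : m ≤ n := Nat.lt_succ_iff.mp (Finset.mem_range.mp hm)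
  rw [← Real.exp_nat_mul, Nat.cast_sub hmn,
    show ((n : ℝ) - m) * (-2 * t) = -2 * ((n : ℝ) - m) * t by ring]
  ring

/-- A binomial weight of low index is dominated by a power of `2nt` times `e^{-2nt}`. -/
theorem binomial_exp_term_le {k m n : ℕ} (hm : m ≤ k) {t : ℝ} (ht : 0 < t) (ht' : t ≤ 1 / 2)
    (hnt : 1 ≤ 2 * (n * t)) :
    (n.choose m : ℝ) * Real.exp (-2 * ((n : ℝ) - (m : ℝ)) * t) *
      (1 - Real.exp (-2 * t)) ^ m ≤
    Real.exp k * ((2 * (n * t)) ^ k * Real.exp (-(2 * (n * t)))) := by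
  have hchoose : (n.choose m : ℝ) ≤ (n : ℝ) ^ m := by exact_mod_cast Nat.choose_le_pow n m
  have hexp : Real.exp (-2 * ((n : ℝ) - m) * t) ≤ Real.exp k * Real.exp (-(2 * (n * t))) := by
    rw [← Real.exp_add, Real.exp_le_exp]
    have hmk : (m : ℝ) ≤ k := by exact_mod_cast hm
    nlinarith [mul_le_mul_of_nonneg_left ht' (Nat.cast_nonneg (α := ℝ) m)]
  have hnonneg : 0 ≤ 1 - Real.exp (-2 * t) :=
    sub_nonneg.mpr (Real.exp_le_one_iff.mpr (by linarith))
  have hle : 1 - Real.exp (-2 * t) ≤ 2 * t := by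
    linarith [Real.add_one_le_exp (-2 * t)]
  calc (n.choose m : ℝ) * Real.exp (-2 * ((n : ℝ) - m) * t) * (1 - Real.exp (-2 * t)) ^ m
      ≤ (n : ℝ) ^ m * (Real.exp k * Real.exp (-(2 * (n * t)))) * (2 * t) ^ m := by gcongr
    _ = Real.exp k * ((2 * (n * t)) ^ m * Real.exp (-(2 * (n * t)))) := by
      simp only [mul_pow]; ring
    _ ≤ Real.exp k * ((2 * (n * t)) ^ k * Real.exp (-(2 * (n * t)))) := by gcongr

/-- The large-`nt` regime in the proof of Proposition 5.1: for every `k ≥ 1` there exists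
`M > 0` such that for all `n ≥ k` and `0 < t < 2^(-k)` with `n·t ≥ M`, one has
`∑_{m=k}^n (n choose m) e^{-2(n-m)t} (1 - e^{-2t})^m ≥ 1/2`. -/
theorem stmt1 (k : ℕ) (hk : 1 ≤ k) :
    ∃ M : ℝ, 0 < M ∧ ∀ n : ℕ, k ≤ n → ∀ t : ℝ, 0 < t → t < (2 : ℝ) ^ (-(k : ℤ)) →
      M ≤ (n : ℝ) * t →
      (1 : ℝ) / 2 ≤ ∑ m ∈ Finset.Icc k n,
          (n.choose m : ℝ) * Real.exp (-2 * ((n : ℝ) - (m : ℝ)) * t) *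
            (1 - Real.exp (-2 * t)) ^ m := by
  have hlim : Filter.Tendsto (fun x : ℝ => k * (Real.exp k * (x ^ k * Real.exp (-x))))
      Filter.atTop (nhds 0) := by
    simpa using
      ((Real.tendsto_pow_mul_exp_neg_atTop_nhds_zero k).const_mul (Real.exp k)).const_mul (k : ℝ)
  obtain ⟨A, hA⟩ := Filter.eventually_atTop.mp
    (hlim.eventually_le_const (show (0 : ℝ) < 1 / 2 by norm_num))
  refine ⟨max A 1, by positivity, fun n hkn t ht htk hM => ?_⟩
  have hA' : A ≤ n * t := (le_max_left A 1).trans hM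
  have h1 : 1 ≤ n * t := (le_max_right A 1).trans hM
  have ht' : t ≤ 1 / 2 := by
    refine htk.le.trans ?_
    calc (2 : ℝ) ^ (-(k : ℤ)) ≤ 2 ^ (-1 : ℤ) :=
          zpow_le_zpow_right₀ (by norm_num) (by omega)
      _ = 1 / 2 := by norm_num
  have hsmall := Finset.sum_le_card_nsmul (Finset.range k) _ _ fun m hm =>
    binomial_exp_term_le (n := n) (Finset.mem_range.mp hm).le ht ht' (by linarith)
  rw [Finset.card_range, nsmul_eq_mul] at hsmall
  have hbound := hA (2 * (n * t)) (by linarith)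
  have hsplit := sum_binomial_exp_eq_one n t
  rw [← Finset.sum_range_add_sum_Ico _ (show k ≤ n + 1 by omega),
    Finset.Ico_add_one_right_eq_Icc] at hsplit
  linarith
end

section
/- Let d ≥ 2 and L ≥ 1 be integers, and let (H_j)_{j∈ℕ} be finite-dimensional complex inner product spaces with dim H_j = d^j. Let H be the Hilbert space direct sum (ℓ²-sum) of the H_j, with P_j : H → H the orthogonal projection onto H_j. Let A : H → H be a bounded linear operator, let k ≥ 1 be an integer, 0 < r < 1, C > 0, and j₀ ∈ ℕ, and assume: (i) P_i A P_j = 0 whenever |i − j| ≥ L; (ii) ‖P_i A P_j‖ ≤ C·r^{jk} for all i and all j ≥ j₀; (iii) d·r^{2k} < 1. Then A is Hilbert–Schmidt: for every Hilbert basis (e_b) of H, Σ_b ‖A e_b‖² < ∞. -/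
/-- Parseval's identity in extended nonnegative form. -/
lemma HilbertBasis.tsum_enorm_inner_sq {𝕜 E ι : Type*} [RCLike 𝕜] [NormedAddCommGroup E]
    [InnerProductSpace 𝕜 E] (b : HilbertBasis ι 𝕜 E) (x : E) :
    ∑' i, ‖(inner 𝕜 (b i) x : 𝕜)‖ₑ ^ 2 = ‖x‖ₑ ^ 2 := by
  have h : HasSum (fun i => ‖(inner 𝕜 (b i) x : 𝕜)‖ ^ 2) (‖x‖ ^ 2) := by
    have h1 := b.hasSum_inner_mul_inner x x
    rw [inner_self_eq_norm_sq_to_K] at h1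
    have h2 := RCLike.hasSum_re 𝕜 h1
    convert h2 using 1
    · ext i
      rw [← inner_conj_symm x (b i), RCLike.conj_mul]
      norm_cast
    · norm_cast
  rw [← ofReal_norm, ← ENNReal.ofReal_pow (norm_nonneg _), ← h.tsum_eq,
    ENNReal.ofReal_tsum_of_nonneg (fun _ => by positivity) h.summable]
  simp only [← ofReal_norm, ENNReal.ofReal_pow (norm_nonneg _)]

/-- The sum of squared norms of `A` along a Hilbert basis equals that of its adjoint along any
Hilbert basis. -/
lemma HilbertBasis.tsum_enorm_sq_eq_adjoint {𝕜 E ι κ : Type*} [RCLike 𝕜] [NormedAddCommGroup E]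
    [InnerProductSpace 𝕜 E] [CompleteSpace E] (e : HilbertBasis ι 𝕜 E) (f : HilbertBasis κ 𝕜 E)
    (A : E →L[𝕜] E) :
    ∑' i, ‖A (e i)‖ₑ ^ 2 = ∑' j, ‖ContinuousLinearMap.adjoint A (f j)‖ₑ ^ 2 := by
  simp_rw [← f.tsum_enorm_inner_sq (A _), ← e.tsum_enorm_inner_sq (ContinuousLinearMap.adjoint A _)]
  rw [ENNReal.tsum_comm]
  refine tsum_congr fun j => tsum_congr fun i => ?_
  rw [ContinuousLinearMap.adjoint_inner_right, ← inner_conj_symm, ← ofReal_norm, ← ofReal_norm,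
    RCLike.norm_conj]

/-- Square-summability of the norms of `A` does not depend on the Hilbert basis. -/
lemma HilbertBasis.summable_norm_sq_of_summable {𝕜 E ι κ : Type*} [RCLike 𝕜]
    [NormedAddCommGroup E] [InnerProductSpace 𝕜 E] [CompleteSpace E] (e : HilbertBasis ι 𝕜 E)
    (f : HilbertBasis κ 𝕜 E) (A : E →L[𝕜] E) (hf : Summable fun j => ‖A (f j)‖ ^ 2) :
    Summable fun i => ‖A (e i)‖ ^ 2 := by
  have h : ∑' i, ‖A (e i)‖ₑ ^ 2 = ∑' j, ‖A (f j)‖ₑ ^ 2 := by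
    rw [e.tsum_enorm_sq_eq_adjoint f, f.tsum_enorm_sq_eq_adjoint f A]
  have key : ∑' i, ‖A (e i)‖ₑ ^ 2 ≠ ⊤ := by
    rw [h]
    simpa only [← ofReal_norm, ENNReal.ofReal_pow (norm_nonneg _)] using hf.tsum_ofReal_ne_top
  simpa using ENNReal.summable_toReal key

/-- A vector is the sum of its projections onto finitely many members of a total orthogonal family
as soon as the other projections vanish. -/
lemma eq_sum_starProjection_of_forall_notMem {𝕜 E ι : Type*} [RCLike 𝕜] [NormedAddCommGroup E]
    [InnerProductSpace 𝕜 E] [CompleteSpace E] (K : ι → Submodule 𝕜 E)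
    [∀ i, (K i).HasOrthogonalProjection]
    (horth : ∀ i j, i ≠ j → ∀ x ∈ K i, ∀ y ∈ K j, (inner 𝕜 x y : 𝕜) = 0)
    (hdense : (⨆ i, K i).topologicalClosure = ⊤) (s : Finset ι) (x : E)
    (hx : ∀ i ∉ s, (K i).starProjection x = 0) :
    x = ∑ i ∈ s, (K i).starProjection x := by
  classical
  rw [← sub_eq_zero]
  have hmem : x - ∑ i ∈ s, (K i).starProjection x ∈ (⨆ i, K i)ᗮ := by
    rw [← Submodule.iInf_orthogonal, Submodule.mem_iInf]
    intro m
    rw [Submodule.mem_orthogonal]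
    intro u hu
    have h1 : inner 𝕜 u x = inner 𝕜 u ((K m).starProjection x) := by
      rw [← sub_eq_zero, ← inner_sub_right]
      exact (K m).sub_starProjection_mem_orthogonal x u hu
    rw [inner_sub_right, inner_sum, h1]
    by_cases hm : m ∈ s
    · rw [Finset.sum_eq_single_of_mem m hm, sub_self]
      intro i _ hi
      exact horth m i hi.symm u hu _ ((K i).starProjection_apply_mem x)
    · rw [hx m hm, inner_zero_right, zero_sub, neg_eq_zero]
      refine Finset.sum_eq_zero fun i hi => ?_
      exact horth m i (fun h => hm (h ▸ hi)) u hu _ ((K i).starProjection_apply_mem x)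
  rwa [(Submodule.topologicalClosure_eq_top_iff).1 hdense, Submodule.mem_bot] at hmem

/-- A total orthogonal family of finite-dimensional subspaces admits an adapted Hilbert basis. -/
lemma exists_hilbertBasis_sigma {𝕜 E ι : Type*} [RCLike 𝕜] [NormedAddCommGroup E]
    [InnerProductSpace 𝕜 E] [CompleteSpace E] (K : ι → Submodule 𝕜 E)
    [∀ i, FiniteDimensional 𝕜 (K i)]
    (horth : ∀ i j, i ≠ j → ∀ x ∈ K i, ∀ y ∈ K j, (inner 𝕜 x y : 𝕜) = 0)
    (hdense : (⨆ i, K i).topologicalClosure = ⊤) :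
    ∃ f : HilbertBasis (Σ i, Fin (Module.finrank 𝕜 (K i))) 𝕜 E, ∀ c, f c ∈ K c.1 := by
  classical
  have hV : OrthogonalFamily 𝕜 (fun i => K i) fun i => (K i).subtypeₗᵢ :=
    fun i j hij x y => horth i j hij x x.2 y y.2
  have ho := hV.orthonormal_sigma_orthonormal
    (v_family := fun i => stdOrthonormalBasis 𝕜 (K i))
    (fun i => (stdOrthonormalBasis 𝕜 (K i)).orthonormal)
  refine ⟨HilbertBasis.mk ho ?_, fun c => ?_⟩
  · rw [← hdense]
    refine Submodule.topologicalClosure_mono (iSup_le fun i => ?_)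
    have h1 : (Submodule.span 𝕜 (Set.range (stdOrthonormalBasis 𝕜 (K i)))).map (K i).subtype
        = K i := by
      rw [← (stdOrthonormalBasis 𝕜 (K i)).coe_toBasis, Module.Basis.span_eq, Submodule.map_top,
        Submodule.range_subtype]
    rw [← h1, Submodule.map_span]
    refine Submodule.span_mono ?_
    rintro _ ⟨_, ⟨a, rfl⟩, rfl⟩
    exact ⟨⟨i, a⟩, rfl⟩
  · rw [HilbertBasis.coe_mk]
    exact (stdOrthonormalBasis 𝕜 (K c.1) c.2).2


/-- The `p = 2` case of Lemma 4.3: a band operator `A` on a graded Hilbert space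
`H = ⊕_j H_j` with `dim H_j = d^j`, block norms `‖P_i A P_j‖ ≤ C r^{jk}` (for `j ≥ j₀`),
and bandwidth `L`, is Hilbert–Schmidt provided `d·r^{2k} < 1`. -/
theorem stmt7 {H : Type*} [NormedAddCommGroup H] [InnerProductSpace ℂ H] [CompleteSpace H]
    (d L : ℕ) (hd : 2 ≤ d) (hL : 1 ≤ L)
    (K : ℕ → Submodule ℂ H) [∀ j, FiniteDimensional ℂ (K j)]
    (horth : ∀ i j, i ≠ j → ∀ x ∈ K i, ∀ y ∈ K j, (inner ℂ x y : ℂ) = 0)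
    (hdim : ∀ j, Module.finrank ℂ (K j) = d ^ j)
    (hdense : (⨆ j, K j).topologicalClosure = ⊤)
    (A : H →L[ℂ] H) (k : ℕ) (hk : 1 ≤ k) (r C : ℝ)
    (hr0 : 0 < r) (hr1 : r < 1) (hC : 0 < C) (j0 : ℕ)
    (hband : ∀ i j, L ≤ Nat.dist i j →
      ((K i).subtypeL ∘L Submodule.orthogonalProjectionOnto (K i)) ∘L
        (A ∘L ((K j).subtypeL ∘L Submodule.orthogonalProjectionOnto (K j))) = 0)
    (hnorm : ∀ i j, j0 ≤ j →
      ‖((K i).subtypeL ∘L Submodule.orthogonalProjectionOnto (K i)) ∘L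
        (A ∘L ((K j).subtypeL ∘L Submodule.orthogonalProjectionOnto (K j)))‖ ≤ C * r ^ (j * k))
    (hsmall : (d : ℝ) * r ^ (2 * k) < 1) :
    ∀ (ι : Type) (e : HilbertBasis ι ℂ H), Summable fun b => ‖A (e b)‖ ^ 2 := by
  intro ι e
  obtain ⟨f, hf⟩ := exists_hilbertBasis_sigma K horth hdense
  refine e.summable_norm_sq_of_summable f A ?_
  have hP : ∀ i j (x : H), x ∈ K j → (K i).starProjection (A x) =
      (((K i).subtypeL ∘L Submodule.orthogonalProjectionOnto (K i)) ∘L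
        (A ∘L ((K j).subtypeL ∘L Submodule.orthogonalProjectionOnto (K j)))) x := by
    intro i j x hx
    change _ = (K i).starProjection (A ((K j).starProjection x))
    rw [Submodule.starProjection_eq_self_iff.2 hx]
  have hlarge : ∀ j, j0 ≤ j → ∀ x ∈ K j, ‖x‖ = 1 → ‖A x‖ ≤ 2 * L * C * r ^ (j * k) := by
    intro j hj x hx hx1
    rw [eq_sum_starProjection_of_forall_notMem K horth hdense (Finset.Ico (j + 1 - L) (j + L)) (A x)
      (fun i hi => ?_)]
    · calc _ ≤ ∑ i ∈ Finset.Ico (j + 1 - L) (j + L), C * r ^ (j * k) := by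
            refine norm_sum_le_of_le _ fun i _ => ?_
            rw [hP i j x hx]
            refine (ContinuousLinearMap.le_opNorm _ x).trans ?_
            rw [hx1, mul_one]
            exact hnorm i j hj
        _ ≤ (2 * L : ℕ) * (C * r ^ (j * k)) := by
            rw [Finset.sum_const, nsmul_eq_mul, Nat.card_Ico]
            gcongr
            omega
        _ = _ := by push_cast; ring
    · rw [hP i j x hx, hband i j, zero_apply]
      rw [Finset.mem_Ico] at hi
      rw [Nat.dist]
      omega
  obtain ⟨M, hM⟩ : ∃ M : ℝ, ∀ j, ∀ x ∈ K j, ‖x‖ = 1 → ‖A x‖ ≤ M * r ^ (j * k) := by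
    refine ⟨2 * L * C + ‖A‖ / r ^ (j0 * k), fun j x hx hx1 => ?_⟩
    rw [add_mul]
    rcases le_total j0 j with hj | hj
    · exact (hlarge j hj x hx hx1).trans (le_add_of_nonneg_right (by positivity))
    · refine le_trans ?_ (le_add_of_nonneg_left (by positivity))
      rw [div_mul_eq_mul_div, le_div_iff₀ (by positivity)]
      have h1 : ‖A x‖ ≤ ‖A‖ := by simpa [hx1] using A.le_opNorm x
      have h2 : r ^ (j0 * k) ≤ r ^ (j * k) :=
        pow_le_pow_of_le_one hr0.le hr1.le (Nat.mul_le_mul_right k hj)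
      gcongr
  have hgeom : Summable fun j => M ^ 2 * ((d : ℝ) * r ^ (2 * k)) ^ j :=
    (summable_geometric_of_lt_one (by positivity) hsmall).mul_left _
  have hbound : ∀ c, ‖A (f c)‖ ^ 2 ≤ M ^ 2 * r ^ (2 * k * c.1) := by
    intro c
    calc ‖A (f c)‖ ^ 2 ≤ (M * r ^ (c.1 * k)) ^ 2 :=
          pow_le_pow_left₀ (norm_nonneg _) (hM c.1 (f c) (hf c) (f.orthonormal.1 c)) 2
      _ = M ^ 2 * r ^ (2 * k * c.1) := by ring
  refine Summable.of_nonneg_of_le (fun _ => by positivity) hbound ?_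
  rw [summable_sigma_of_nonneg (fun _ => mul_nonneg (sq_nonneg M) (by positivity))]
  refine ⟨fun j => (hasSum_fintype _).summable, hgeom.congr fun j => ?_⟩
  dsimp only
  rw [tsum_fintype, Finset.sum_const, Finset.card_univ, Fintype.card_fin, hdim, nsmul_eq_mul]
  push_cast
  ring
end

section
/- Let 1 ≤ m ≤ k ≤ n be natural numbers, let π ∈ P_{1,2}^{m,k}(n), and let q be a real number. For each subset S of the set of pairs of π, with |S| = j, let ρ_S ∈ P_{1,2}^{j,k}(n) be the partition whose pairs are exactly the pairs in S and whose remaining blocks are singletons, and let σ_S ∈ P_{1,2}^{m−j,k−j}(n−2j) be the partition obtained from the pairs of π not in S by relabeling the surviving points via the unique increasing bijection from {1,…,n} minus the union of the pairs in S onto {1,…,n−2j}. Then Σ_{S ⊆ pairs(π)} (−1)^{|S|} · q^{ι′(ρ_S) + ι(σ_S)} = 0. -/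
/-- A partition of `{1,…,n}` all of whose blocks are singletons or pairs, encoded as a
finite set of pairwise disjoint nonempty blocks covering `Finset.Icc 1 n`. -/
def IsP12 (n : ℕ) (ρ : Finset (Finset ℕ)) : Prop :=
  (ρ : Set (Finset ℕ)).PairwiseDisjoint id ∧
    ρ.sup id = Finset.Icc 1 n ∧ ∀ b ∈ ρ, b.card = 1 ∨ b.card = 2

/-- The crossing number `ι` of a singleton/pair partition: the number of pairs of pairs
`{i,j}, {k,l}` with `i < k < j < l`, plus the number of (pair `{i,j}`, singleton `{k}`)
with `i < k < j`. -/
def iotaCross (ρ : Finset (Finset ℕ)) : ℕ :=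
  ((ρ ×ˢ ρ).filter fun p =>
      ∃ i ∈ p.1, ∃ j ∈ p.1, ∃ k ∈ p.2, ∃ l ∈ p.2, i < k ∧ k < j ∧ j < l).card
  + ((ρ ×ˢ ρ).filter fun p =>
      p.2.card = 1 ∧ ∃ i ∈ p.1, ∃ j ∈ p.1, ∃ k ∈ p.2, i < k ∧ k < j).card

/-- The recursive definition of the modified crossing number `ι′`, as a relation. -/
inductive Iota' : Finset (Finset ℕ) → ℕ → Prop
  | base (ρ : Finset (Finset ℕ)) (h : ∀ b ∈ ρ, b.card = 1) : Iota' ρ 0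
  | step (ρ : Finset (Finset ℕ)) (v ℓ1 ℓ2 : ℕ)
      (h1 : ({ℓ1} : Finset ℕ) ∈ ρ) (h2 : ({ℓ2} : Finset ℕ) ∈ ρ) (hlt : ℓ1 < ℓ2)
      (hmin : ∀ b ∈ ρ, b.card = 2 → ∀ x ∈ b, ℓ1 < x)
      (hv : Iota' ρ v) :
      Iota' (insert ({ℓ1, ℓ2} : Finset ℕ) ((ρ.erase {ℓ1}).erase {ℓ2}))
        (v + (ρ.filter fun b => b.card = 1 ∧ ∀ m ∈ b, ℓ1 < m ∧ m < ℓ2).card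
           + 2 * (ρ.filter fun b => b.card = 2 ∧ ∀ x ∈ b, ℓ1 < x ∧ x < ℓ2).card)

/-- The block `a` crosses the block `b`, with `a` starting first. -/
def Crosses (a b : Finset ℕ) : Prop :=
  ∃ i ∈ a, ∃ j ∈ a, ∃ k ∈ b, ∃ l ∈ b, i < k ∧ k < j ∧ j < l

/-- The block `a` covers the singleton block `b`. -/
def CoversSingleton (a b : Finset ℕ) : Prop :=
  b.card = 1 ∧ ∃ i ∈ a, ∃ j ∈ a, ∃ k ∈ b, i < k ∧ k < j

/-- The block `b` is a pair with one point in `[0, N]` and the other beyond `N`. -/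
def Straddles (N : ℕ) (b : Finset ℕ) : Prop :=
  ∃ i j, i ≤ N ∧ N < j ∧ b = {i, j}

open Classical in
/-- The number of ordered crossings within a family of blocks. -/
noncomputable def crossCount (S : Finset (Finset ℕ)) : ℕ :=
  ∑ a ∈ S, ∑ b ∈ S, if Crosses a b then 1 else 0

open Classical in
/-- The number of ways (zero, one or two) in which two blocks cross. -/
noncomputable def mutualCross (a b : Finset ℕ) : ℕ :=
  (if Crosses a b then 1 else 0) + (if Crosses b a then 1 else 0)

/-- The number of points lying strictly between the extreme points of a block. -/
def gap (b : Finset ℕ) : ℕ :=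
  ((Finset.range (b.sup id)).filter fun m => ∃ i ∈ b, i < m).card

/-- The partition of `{1,…,n}` with the blocks in `S` and singletons otherwise. -/
def withSingletons (n : ℕ) (S : Finset (Finset ℕ)) : Finset (Finset ℕ) :=
  S ∪ ((Finset.Icc 1 n \ S.sup id).image fun x => ({x} : Finset ℕ))

lemma sum_sum_insert {α : Type*} [DecidableEq α] (f : α → α → ℕ) {p : α} {s : Finset α}
    (hp : p ∉ s) :
    ∑ a ∈ insert p s, ∑ b ∈ insert p s, f a b =
      f p p + ∑ b ∈ s, (f p b + f b p) + ∑ a ∈ s, ∑ b ∈ s, f a b := by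
  simp only [Finset.sum_insert hp, Finset.sum_add_distrib]
  ring

open Classical in
lemma iotaCross_eq_sum (ρ : Finset (Finset ℕ)) :
    iotaCross ρ = ∑ a ∈ ρ, ∑ b ∈ ρ,
      ((if Crosses a b then 1 else 0) + (if CoversSingleton a b then 1 else 0)) := by
  simp only [iotaCross, Finset.card_filter, Finset.sum_product, Finset.sum_add_distrib, Crosses,
    CoversSingleton]
  congr 1 <;> exact Finset.sum_congr rfl fun a _ => Finset.sum_congr rfl fun b _ => by congr

lemma gap_pair {l r : ℕ} (h : l < r) : gap {l, r} = (Finset.Ioo l r).card := by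
  unfold gap
  congr 1
  ext m
  simp
  omega

lemma crosses_pair_iff {N l r i j : ℕ} (hl : l ≤ N) (hr : N < r) (hi : i ≤ N) (hj : N < j) :
    Crosses {l, r} {i, j} ↔ l < i ∧ r < j := by
  simp [Crosses]
  omega

lemma not_crosses_self_pair (l r : ℕ) : ¬ Crosses {l, r} {l, r} := by
  simp [Crosses]
  omega

lemma not_crosses_singleton_left (x : ℕ) (b : Finset ℕ) : ¬ Crosses {x} b := by
  simp only [Crosses, Finset.mem_singleton]
  rintro ⟨i, rfl, j, rfl, k, -, l, -, h⟩
  omega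

lemma not_crosses_singleton_right (x : ℕ) (b : Finset ℕ) : ¬ Crosses b {x} := by
  simp only [Crosses, Finset.mem_singleton]
  rintro ⟨i, -, j, -, k, rfl, l, rfl, h⟩
  omega

lemma mutualCross_singleton (x : ℕ) (b : Finset ℕ) : mutualCross b {x} = 0 := by
  simp [mutualCross, not_crosses_singleton_left, not_crosses_singleton_right]

lemma coversSingleton_pair_iff {l r : ℕ} (h : l < r) (b : Finset ℕ) :
    CoversSingleton {l, r} b ↔ b.card = 1 ∧ ∀ m ∈ b, l < m ∧ m < r := by
  refine and_congr_right fun hb => ?_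
  obtain ⟨x, rfl⟩ := Finset.card_eq_one.1 hb
  simp
  omega

lemma Straddles.card {N : ℕ} {b : Finset ℕ} (h : Straddles N b) : b.card = 2 := by
  obtain ⟨i, j, hi, hj, rfl⟩ := h
  exact Finset.card_pair (by omega)

open Classical in
lemma card_inter_Ioo_of_straddles {N l r : ℕ} {b : Finset ℕ} (hl : l ≤ N) (hr : N < r)
    (hb : Straddles N b) (hd : Disjoint {l, r} b) :
    (b ∩ Finset.Ioo l r).card =
      2 * (if b.card = 2 ∧ ∀ x ∈ b, l < x ∧ x < r then 1 else 0) + mutualCross {l, r} b := by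
  have hc := hb.card
  obtain ⟨i, j, hi, hj, rfl⟩ := hb
  have hli : l ≠ i := by rintro rfl; simp at hd
  have hrj : r ≠ j := by rintro rfl; simp at hd
  have hij : i ≠ j := by omega
  have hn : (({i, j} : Finset ℕ).card = 2 ∧ ∀ x ∈ ({i, j} : Finset ℕ), l < x ∧ x < r) ↔
      l < i ∧ j < r := by
    simp [hc]
    omega
  simp only [mutualCross, crosses_pair_iff hl hr hi hj, crosses_pair_iff hi hj hl hr, hn]
  rw [← Finset.filter_mem_eq_inter, Finset.card_filter, Finset.sum_pair hij]
  simp only [Finset.mem_Ioo]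
  split_ifs <;> omega

open Classical in
/-- How many points of a block lie inside a pair `{l, r}`, for singletons and straddling pairs. -/
lemma card_inter_Ioo {N l r : ℕ} {b : Finset ℕ} (hl : l ≤ N) (hr : N < r)
    (hb : b.card = 1 ∨ Straddles N b ∧ Disjoint {l, r} b) :
    (b ∩ Finset.Ioo l r).card =
      (if b.card = 1 ∧ ∀ m ∈ b, l < m ∧ m < r then 1 else 0)
        + 2 * (if b.card = 2 ∧ ∀ x ∈ b, l < x ∧ x < r then 1 else 0) + mutualCross {l, r} b := by
  rcases hb with hb | ⟨hb, hd⟩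
  · obtain ⟨x, rfl⟩ := Finset.card_eq_one.1 hb
    rw [mutualCross_singleton]
    by_cases h : l < x ∧ x < r <;> simp [h]
  · rw [card_inter_Ioo_of_straddles hl hr hb hd]
    simp [hb.card]

lemma IsP12.sum_card_inter {n : ℕ} {ρ : Finset (Finset ℕ)} (hρ : IsP12 n ρ) {l r : ℕ}
    (hl : 1 ≤ l) (hr : r ≤ n) :
    ∑ b ∈ ρ, (b ∩ Finset.Ioo l r).card = (Finset.Ioo l r).card := by
  rw [← Finset.card_biUnion]
  · congr 1
    rw [← Finset.biUnion_inter, ← Finset.sup_eq_biUnion]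
    change ρ.sup id ∩ _ = _
    rw [hρ.2.1, Finset.inter_eq_right]
    intro x hx
    simp at hx ⊢
    omega
  · intro a ha b hb hab
    exact (hρ.1 ha hb hab).mono Finset.inter_subset_left Finset.inter_subset_left

lemma isP12_withSingletons {n : ℕ} {S : Finset (Finset ℕ)}
    (hd : (S : Set (Finset ℕ)).PairwiseDisjoint id) (hsub : ∀ b ∈ S, b ⊆ Finset.Icc 1 n)
    (hc : ∀ b ∈ S, b.card = 2) : IsP12 n (withSingletons n S) := by
  have key : ∀ a ∈ S, ∀ x ∉ S.sup id, x ∉ a := fun a ha x hx hxa =>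
    hx (Finset.mem_sup.2 ⟨a, ha, hxa⟩)
  refine ⟨?_, ?_, ?_⟩
  · intro a ha b hb hab
    simp only [withSingletons, Finset.coe_union, Finset.coe_image, Set.mem_union, Set.mem_image,
      Finset.mem_coe, Finset.mem_sdiff] at ha hb
    simp only [Function.onFun, id]
    rcases ha with ha | ⟨x, ⟨-, hx⟩, rfl⟩ <;> rcases hb with hb | ⟨y, ⟨-, hy⟩, rfl⟩
    · exact hd ha hb hab
    · simpa using key a ha y hy
    · simpa using key b hb x hx
    · simpa using fun h : x = y => hab (by rw [h])
  · ext x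
    simp only [withSingletons, Finset.sup_union, Finset.sup_eq_union, Finset.mem_union]
    have h1 : x ∈ ((Finset.Icc 1 n \ S.sup id).image fun x => ({x} : Finset ℕ)).sup id ↔
        x ∈ Finset.Icc 1 n \ S.sup id := by
      simp [Finset.mem_sup]
    rw [h1, Finset.mem_sdiff]
    constructor
    · rintro (h | h)
      · obtain ⟨b, hb, hx⟩ := Finset.mem_sup.1 h
        exact hsub b hb hx
      · exact h.1
    · intro h
      by_cases hx : x ∈ S.sup id
      · exact Or.inl hx
      · exact Or.inr ⟨h, hx⟩
  · intro b hb
    simp only [withSingletons, Finset.mem_union, Finset.mem_image] at hb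
    rcases hb with hb | ⟨x, -, rfl⟩
    · exact Or.inr (hc b hb)
    · simp

lemma withSingletons_insert_pair {n l r : ℕ} {S : Finset (Finset ℕ)}
    (hc : ∀ b ∈ S, b.card = 2) :
    withSingletons n (insert {l, r} S) =
      insert {l, r} (((withSingletons n S).erase {l}).erase {r}) := by
  have hne : ∀ b ∈ S, ∀ x : ℕ, b ≠ {x} := by
    rintro b hb x rfl
    simpa using hc _ hb
  ext b
  simp only [withSingletons, Finset.mem_union, Finset.mem_insert, Finset.mem_erase,
    Finset.mem_image, Finset.mem_sdiff, Finset.sup_insert, Finset.sup_eq_union, id,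
    Finset.mem_singleton]
  constructor
  · rintro ((h | h) | ⟨x, ⟨h1, h2⟩, rfl⟩)
    · exact Or.inl h
    · exact Or.inr ⟨hne b h r, hne b h l, Or.inl h⟩
    · refine Or.inr ⟨?_, ?_, Or.inr ⟨x, ⟨h1, ?_⟩, rfl⟩⟩
      · simp; tauto
      · simp; tauto
      · tauto
  · rintro (h | ⟨h1, h2, h | ⟨x, ⟨h3, h4⟩, rfl⟩⟩)
    · exact Or.inl (Or.inl h)
    · exact Or.inl (Or.inr h)
    · simp at h1 h2
      exact Or.inr ⟨x, ⟨h3, by tauto⟩, rfl⟩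

lemma singleton_mem_withSingletons {n x : ℕ} {S : Finset (Finset ℕ)} (hx : x ∈ Finset.Icc 1 n)
    (hS : ∀ b ∈ S, x ∉ b) : {x} ∈ withSingletons n S := by
  simp only [withSingletons, Finset.mem_union, Finset.mem_image, Finset.mem_sdiff,
    Finset.mem_sup, not_exists, not_and]
  exact Or.inr ⟨x, ⟨hx, hS⟩, rfl⟩

lemma crossCount_insert_pair {l r : ℕ} {S : Finset (Finset ℕ)} (h : {l, r} ∉ S) :
    crossCount (insert {l, r} S) = ∑ b ∈ S, mutualCross {l, r} b + crossCount S := by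
  classical
  unfold crossCount mutualCross
  rw [sum_sum_insert _ h]
  simp [not_crosses_self_pair]

lemma sum_mutualCross_withSingletons (n : ℕ) (S : Finset (Finset ℕ)) (a : Finset ℕ) :
    ∑ b ∈ withSingletons n S, mutualCross a b = ∑ b ∈ S, mutualCross a b := by
  refine (Finset.sum_subset Finset.subset_union_left ?_).symm
  intro b hb hbS
  obtain h | h := Finset.mem_union.1 hb
  · exact absurd h hbS
  · obtain ⟨x, -, rfl⟩ := Finset.mem_image.1 h
    exact mutualCross_singleton x a

/-- The modified crossing number of a partition with straddling pairs `S` is the total gap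
of these pairs minus their number of crossings. -/
lemma exists_iota'_add_crossCount {n N : ℕ} {S : Finset (Finset ℕ)}
    (hd : (S : Set (Finset ℕ)).PairwiseDisjoint id) (hsub : ∀ b ∈ S, b ⊆ Finset.Icc 1 n)
    (hs : ∀ b ∈ S, Straddles N b) :
    ∃ v, Iota' (withSingletons n S) v ∧ v + crossCount S = ∑ b ∈ S, gap b := by
  classical
  induction S using Finset.induction_on_min_value (fun b : Finset ℕ => b.min) with
  | empty =>
    refine ⟨0, Iota'.base _ ?_, by simp [crossCount]⟩
    simp only [withSingletons, Finset.empty_union, Finset.forall_mem_image]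
    simp
  | insert a S haS hmin ih =>
    have hdS : (S : Set (Finset ℕ)).PairwiseDisjoint id := hd.subset (by simp)
    have hsS : ∀ b ∈ S, Straddles N b := fun b hb => hs b (by simp [hb])
    have hsubS : ∀ b ∈ S, b ⊆ Finset.Icc 1 n := fun b hb => hsub b (by simp [hb])
    have hcS : ∀ b ∈ S, b.card = 2 := fun b hb => (hsS b hb).card
    obtain ⟨v, hv, hvS⟩ := ih hdS hsubS hsS
    have hdis : ∀ b ∈ S, Disjoint a b := fun b hb =>
      hd (by simp) (by simp [hb]) (fun h => haS (h ▸ hb))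
    have hasub := hsub a (by simp)
    obtain ⟨l, r, hl, hr, rfl⟩ := hs a (by simp)
    have hlr : l < r := by omega
    have hlmem : l ∈ Finset.Icc 1 n := hasub (by simp)
    have hrmem : r ∈ Finset.Icc 1 n := hasub (by simp)
    have hP := isP12_withSingletons hdS hsubS hcS
    have hlS : ∀ b ∈ S, l ∉ b := fun b hb => Finset.disjoint_left.1 (hdis b hb) (by simp)
    have hrS : ∀ b ∈ S, r ∉ b := fun b hb => Finset.disjoint_left.1 (hdis b hb) (by simp)
    have hblock : ∀ b ∈ withSingletons n S, b.card = 1 ∨ b ∈ S := by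
      intro b hb
      obtain h | h := Finset.mem_union.1 hb
      · exact Or.inr h
      · obtain ⟨x, -, rfl⟩ := Finset.mem_image.1 h
        simp
    have hstep := Iota'.step (withSingletons n S) v l r
      (singleton_mem_withSingletons hlmem hlS) (singleton_mem_withSingletons hrmem hrS) hlr
      (by
        intro b hb hb2 x hx
        have hbS : b ∈ S := (hblock b hb).resolve_left (by omega)
        have h1 : ({l, r} : Finset ℕ).min ≤ x := (hmin b hbS).trans (Finset.min_le hx)
        have h2 : min l r ≤ x := by
          simpa [Finset.min_insert, ← WithTop.coe_min] using h1
        have h3 : l ≠ x := by rintro rfl; exact hlS b hbS hx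
        omega)
      hv
    rw [← withSingletons_insert_pair hcS] at hstep
    refine ⟨_, hstep, ?_⟩
    rw [crossCount_insert_pair haS, Finset.sum_insert haS, gap_pair hlr, ← hvS,
      ← hP.sum_card_inter (Finset.mem_Icc.1 hlmem).1 (Finset.mem_Icc.1 hrmem).2,
      ← sum_mutualCross_withSingletons n S,
      Finset.sum_congr rfl fun b hb => card_inter_Ioo hl hr
        ((hblock b hb).imp_right fun h => ⟨hsS b h, hdis b h⟩),
      Finset.sum_add_distrib, Finset.sum_add_distrib, ← Finset.mul_sum, Finset.card_filter,
      Finset.card_filter]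
    ring

lemma iotaCross_image {ρ : Finset (Finset ℕ)} {D : Set ℕ} {f : ℕ → ℕ} (hf : StrictMonoOn f D)
    (hρ : ∀ b ∈ ρ, (b : Set ℕ) ⊆ D) :
    iotaCross (ρ.image fun b => b.image f) = iotaCross ρ := by
  classical
  have hinj : Set.InjOn (fun b : Finset ℕ => b.image f) ρ := by
    intro a ha b hb hab
    have h : f '' a = f '' b := by
      have := congrArg (fun s : Finset ℕ => (s : Set ℕ)) hab
      simpa using this
    exact_mod_cast (hf.injOn.image_eq_image_iff (hρ a ha) (hρ b hb)).1 h
  rw [iotaCross_eq_sum, iotaCross_eq_sum, Finset.sum_image hinj]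
  refine Finset.sum_congr rfl fun a ha => ?_
  rw [Finset.sum_image hinj]
  refine Finset.sum_congr rfl fun b hb => ?_
  have hlt : ∀ {c d : Finset ℕ}, c ∈ ρ → d ∈ ρ → ∀ {x y}, x ∈ c → y ∈ d → (f x < f y ↔ x < y) :=
    fun hc hd _ _ hx hy => hf.lt_iff_lt (hρ _ hc hx) (hρ _ hd hy)
  have h1 : Crosses (a.image f) (b.image f) ↔ Crosses a b := by
    simp only [Crosses, Finset.exists_mem_image]
    refine exists_congr fun i => and_congr_right fun hi => exists_congr fun j =>
      and_congr_right fun hj => exists_congr fun k => and_congr_right fun hk =>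
      exists_congr fun l => and_congr_right fun hl => ?_
    rw [hlt ha hb hi hk, hlt hb ha hk hj, hlt ha hb hj hl]
  have h2 : CoversSingleton (a.image f) (b.image f) ↔ CoversSingleton a b := by
    simp only [CoversSingleton, Finset.exists_mem_image,
      Finset.card_image_of_injOn (hf.injOn.mono (hρ b hb))]
    refine and_congr_right fun _ => exists_congr fun i => and_congr_right fun hi =>
      exists_congr fun j => and_congr_right fun hj => exists_congr fun k =>
      and_congr_right fun hk => ?_
    rw [hlt ha hb hi hk, hlt hb ha hk hj]
  simp only [h1, h2]

lemma strictMonoOn_card_filter_le (D : Finset ℕ) :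
    StrictMonoOn (fun x => (D.filter fun y => y ≤ x).card) D := by
  intro x _ y hy hxy
  refine Finset.card_lt_card (Finset.ssubset_iff_of_subset ?_ |>.2 ⟨y, ?_, ?_⟩)
  · exact Finset.monotone_filter_right _ fun z _ hz => hz.trans hxy.le
  · simpa using hy
  · simpa using fun _ => hxy

lemma iotaCross_relabel {n : ℕ} {π S : Finset (Finset ℕ)} (hπ : IsP12 n π) (hS : S ⊆ π) :
    iotaCross ((π \ S).image fun b =>
      b.image fun x => ((Finset.Icc 1 n \ S.sup id).filter fun y => y ≤ x).card) =
      iotaCross (π \ S) := by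
  refine iotaCross_image (strictMonoOn_card_filter_le _) ?_
  intro b hb x hx
  obtain ⟨hbπ, hbS⟩ := Finset.mem_sdiff.1 hb
  simp only [Finset.mem_coe, Finset.mem_sdiff]
  refine ⟨hπ.2.1 ▸ Finset.mem_sup.2 ⟨b, hbπ, hx⟩, fun h => ?_⟩
  obtain ⟨c, hc, hxc⟩ := Finset.mem_sup.1 h
  have hne : b ≠ c := by rintro rfl; exact hbS hc
  exact Finset.disjoint_left.1 (hπ.1 hbπ (hS hc) hne) hx hxc

open Classical in
lemma iotaCross_insert_pair {l r : ℕ} {ρ : Finset (Finset ℕ)} (hlr : l < r) (h : {l, r} ∉ ρ) :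
    iotaCross (insert {l, r} ρ) = iotaCross ρ +
      ∑ b ∈ ρ, (mutualCross {l, r} b +
        if b.card = 1 ∧ ∀ m ∈ b, l < m ∧ m < r then 1 else 0) := by
  have hcov : ∀ b, ¬ CoversSingleton b {l, r} := fun b hb => by
    have := hb.1
    rw [Finset.card_pair hlr.ne] at this
    omega
  rw [iotaCross_eq_sum, sum_sum_insert _ h, iotaCross_eq_sum]
  simp only [hcov, not_crosses_self_pair, coversSingleton_pair_iff hlr, if_false, mutualCross]
  rw [add_comm]
  congr 1
  simp only [zero_add, add_zero]
  exact Finset.sum_congr rfl fun b _ => by ring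

/-- Moving a pair with no pair nested inside it does not change the total exponent. -/
lemma iota'_add_iotaCross_insert {n N : ℕ} {π S : Finset (Finset ℕ)} {l r v v' : ℕ}
    (hπ : IsP12 n π) (hs : ∀ b ∈ π, b.card = 2 → Straddles N b) (hl : l ≤ N) (hr : N < r)
    (hp : {l, r} ∈ π) (hmax : ∀ b ∈ π, b.card = 2 → ∃ x ∈ b, x ≤ l)
    (hS : S ⊆ π) (hS2 : ∀ b ∈ S, b.card = 2) (hpS : {l, r} ∉ S)
    (hv : v + crossCount S = ∑ b ∈ S, gap b)
    (hv' : v' + crossCount (insert {l, r} S) = ∑ b ∈ insert {l, r} S, gap b) :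
    v' + iotaCross (π \ insert {l, r} S) = v + iotaCross (π \ S) := by
  classical
  have hlr : l < r := by omega
  have hsub : ({l, r} : Finset ℕ) ⊆ Finset.Icc 1 n := hπ.2.1 ▸ Finset.le_sup (f := id) hp
  have hlmem := Finset.mem_Icc.1 (hsub (show l ∈ _ by simp))
  have hrmem := Finset.mem_Icc.1 (hsub (show r ∈ _ by simp))
  have hsplit : π \ S = insert {l, r} (π \ insert {l, r} S) := by
    ext b
    simp only [Finset.mem_sdiff, Finset.mem_insert]
    by_cases h : b = {l, r}
    · simp [h, hp, hpS]
    · simp [h]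
  have hpnot : {l, r} ∉ π \ insert {l, r} S := by simp
  have hinter : ∀ b ∈ π, b ≠ {l, r} → (b ∩ Finset.Ioo l r).card = mutualCross {l, r} b +
      if b.card = 1 ∧ ∀ m ∈ b, l < m ∧ m < r then 1 else 0 := by
    intro b hb hne
    have hnest : ¬ (b.card = 2 ∧ ∀ x ∈ b, l < x ∧ x < r) := by
      rintro ⟨h2, h⟩
      obtain ⟨x, hx, hxl⟩ := hmax b hb h2
      have := h x hx
      omega
    rw [card_inter_Ioo hl hr ((hπ.2.2 b hb).imp_right fun h =>
      ⟨hs b hb h, hπ.1 hp hb hne.symm⟩), if_neg hnest]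
    ring
  have hgap : gap {l, r} = ∑ b ∈ π \ insert {l, r} S, (mutualCross {l, r} b +
      if b.card = 1 ∧ ∀ m ∈ b, l < m ∧ m < r then 1 else 0) +
      ∑ b ∈ S, mutualCross {l, r} b := by
    rw [gap_pair hlr, ← hπ.sum_card_inter hlmem.1 hrmem.2, ← Finset.sum_sdiff hS, hsplit,
      Finset.sum_insert hpnot]
    have h0 : (({l, r} : Finset ℕ) ∩ Finset.Ioo l r).card = 0 := by
      rw [Finset.card_eq_zero, ← Finset.disjoint_iff_inter_eq_empty]
      simp
    rw [h0, zero_add]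
    congr 1
    · refine Finset.sum_congr rfl fun b hb => hinter b (Finset.mem_sdiff.1 hb).1 ?_
      rintro rfl
      exact hpnot hb
    · refine Finset.sum_congr rfl fun b hb => ?_
      rw [hinter b (hS hb) (by rintro rfl; exact hpS hb)]
      simp [hS2 b hb]
  rw [crossCount_insert_pair hpS, Finset.sum_insert hpS] at hv'
  rw [hsplit, iotaCross_insert_pair hlr hpnot]
  omega

/-- The sign-cancellation claim inside Proposition 3.10: for `π ∈ P_{1,2}^{m,k}(n)` with
`1 ≤ m`, summing over the subsets `S` of the pairs of `π`, with `ρ_S` the partition whose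
pairs are exactly `S` (all other points singletons) and `σ_S` the partition obtained from
the blocks of `π` not in `S` by relabeling along the increasing bijection onto
`{1,…,n−2|S|}`, one has `∑_S (−1)^{|S|} q^{ι′(ρ_S) + ι(σ_S)} = 0`. -/
theorem stmt10 (n k m : ℕ) (hm : 1 ≤ m) (hmk : m ≤ k) (hkn : k ≤ n) (q : ℝ)
    (π : Finset (Finset ℕ)) (hπ : IsP12 n π)
    (hstraddle : ∀ b ∈ π, b.card = 2 → ∀ i ∈ b, ∀ l ∈ b, i < l → i ≤ n - k ∧ n - k + 1 ≤ l)
    (hpairs : (π.filter fun b => b.card = 2).card = m)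
    (iota' : Finset (Finset ℕ) → ℕ) (hiota' : ∀ ρ v, Iota' ρ v → iota' ρ = v) :
    ∑ S ∈ (π.filter fun b => b.card = 2).powerset,
      (-1 : ℝ) ^ S.card *
        q ^ (iota' (S ∪ ((Finset.Icc 1 n \ S.sup id).image fun x => ({x} : Finset ℕ)))
          + iotaCross ((π \ S).image fun b =>
              b.image fun x => ((Finset.Icc 1 n \ S.sup id).filter fun y => y ≤ x).card)) = 0 := by
  set N := n - k
  set Q := π.filter fun b => b.card = 2
  have hs : ∀ b ∈ π, b.card = 2 → Straddles N b := by
    intro b hb h2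
    obtain ⟨x, y, hxy, rfl⟩ := Finset.card_eq_two.1 h2
    rcases lt_or_gt_of_ne hxy with h | h
    · have := hstraddle _ hb h2 x (by simp) y (by simp) h
      exact ⟨x, y, this.1, this.2, rfl⟩
    · have := hstraddle _ hb h2 y (by simp) x (by simp) h
      exact ⟨y, x, this.1, this.2, Finset.pair_comm x y⟩
  have hQne : Q.Nonempty := Finset.card_pos.1 (by omega)
  obtain ⟨p, hpQ, hpmax⟩ := Q.exists_max_image (fun b : Finset ℕ => b.min) hQne
  obtain ⟨hp, hp2⟩ := Finset.mem_filter.1 hpQ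
  obtain ⟨l, r, hl, hr, rfl⟩ := hs p hp hp2
  have hmax : ∀ b ∈ π, b.card = 2 → ∃ x ∈ b, x ≤ l := by
    intro b hb h2
    have hne : b.Nonempty := Finset.card_pos.1 (by omega)
    refine ⟨b.min' hne, b.min'_mem hne, ?_⟩
    have h1 := (hpmax b (Finset.mem_filter.2 ⟨hb, h2⟩)).trans
      (Finset.min_le (show l ∈ ({l, r} : Finset ℕ) by simp))
    rw [← Finset.coe_min' hne] at h1
    exact_mod_cast h1
  have hval : ∀ S ⊆ Q, iota' (withSingletons n S) + crossCount S = ∑ b ∈ S, gap b := by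
    intro S hS
    have hSπ : S ⊆ π := hS.trans (Finset.filter_subset _ _)
    obtain ⟨v, hv, hvS⟩ := exists_iota'_add_crossCount (n := n) (N := N) (S := S)
      (hπ.1.subset (by exact_mod_cast hSπ))
      (fun b hb => hπ.2.1 ▸ Finset.le_sup (f := id) (hSπ hb))
      (fun b hb => hs b (hSπ hb) (Finset.mem_filter.1 (hS hb)).2)
    rw [hiota' _ _ hv, hvS]
  rw [← Finset.insert_erase hpQ, Finset.sum_powerset_insert (Finset.notMem_erase _ _),
    ← Finset.sum_add_distrib]
  refine Finset.sum_eq_zero fun S hS => ?_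
  have hSQ : S ⊆ Q.erase {l, r} := Finset.mem_powerset.1 hS
  have hSQ' : S ⊆ Q := hSQ.trans (Finset.erase_subset _ _)
  have hSπ : S ⊆ π := hSQ'.trans (Finset.filter_subset _ _)
  have hpS : {l, r} ∉ S := fun h => by simpa using hSQ h
  have hIQ : insert {l, r} S ⊆ Q := Finset.insert_subset hpQ hSQ'
  have key := iota'_add_iotaCross_insert hπ hs hl hr hp hmax hSπ
    (fun b hb => (Finset.mem_filter.1 (hSQ' hb)).2) hpS (hval S hSQ') (hval _ hIQ)
  rw [iotaCross_relabel hπ hSπ, iotaCross_relabel hπ (hIQ.trans (Finset.filter_subset _ _)),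
    Finset.card_insert_of_notMem hpS, pow_succ]
  unfold withSingletons at key
  rw [key]
  ring
end
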